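/- Fix y ∈ ℝⁿ and let z̃ ∈ ℝⁿ be a global minimizer over z ∈ ℝⁿ of z ↦ C^{2/3}_{λ,μ}(z, y). Then for every index i, setting λ_i = λμ/(|y_i| + ε_i)^{2/3 − p} and t_{2/3,λ_i} = (48^{1/4}/3)·λ_i^{3/4}: if |[B_μ(y)]_i| > t_{2/3,λ_i} then z̃_i = f_{2/3,λ_i}([B_μ(y)]_i), and if |[B_μ(y)]_i| < t_{2/3,λ_i} then z̃_i = 0. -/

import Mathlib

/-- `B_μ(y) = y + μ·Aᵀ(b − Ay)`. -/
noncomputable def Bmu {m n : ℕ} (A : Matrix (Fin m) (Fin n) ℝ) (b : Fin m → ℝ)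
    (μ : ℝ) (y : Fin n → ℝ) : Fin n → ℝ :=
  y + μ • (A.transpose.mulVec (b - A.mulVec y))

/-- The objective `C^θ_λ(z) = ‖Az − b‖₂² + λ·Σᵢ |zᵢ|^θ/(|zᵢ| + εᵢ)^{θ−p}`. -/
noncomputable def Cobj {m n : ℕ} (A : Matrix (Fin m) (Fin n) ℝ) (b : Fin m → ℝ)
    (lam p θ : ℝ) (ε : Fin n → ℝ) (z : Fin n → ℝ) : ℝ :=
  ∑ j, ((A.mulVec z - b) j) ^ 2 +
    lam * ∑ i, |z i| ^ θ / (|z i| + ε i) ^ (θ - p)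

/-- The surrogate functional
`C^θ_{λ,μ}(z,y) = μ‖Az − b‖₂² + λμ·Σᵢ |zᵢ|^θ/(|yᵢ| + εᵢ)^{θ−p} − μ‖Az − Ay‖₂² + ‖z − y‖₂²`. -/
noncomputable def Csur {m n : ℕ} (A : Matrix (Fin m) (Fin n) ℝ) (b : Fin m → ℝ)
    (lam μ p θ : ℝ) (ε : Fin n → ℝ) (z y : Fin n → ℝ) : ℝ :=
  μ * ∑ j, ((A.mulVec z - b) j) ^ 2 +
    lam * μ * ∑ i, |z i| ^ θ / (|y i| + ε i) ^ (θ - p) -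
    μ * ∑ j, ((A.mulVec z - A.mulVec y) j) ^ 2 +
    ∑ i, (z i - y i) ^ 2

/-- `arccosh x = log (x + √(x² − 1))`. -/
noncomputable def arccosh (x : ℝ) : ℝ := Real.log (x + Real.sqrt (x ^ 2 - 1))

/-- The auxiliary function `Φ_{2/3,λ}`. -/
noncomputable def phi23 (lam r : ℝ) : ℝ :=
  2 / Real.sqrt 3 * lam ^ ((1 : ℝ) / 4) *
    (Real.cosh ((1 / 3) * arccosh ((27 / 16) * lam ^ (-(3 : ℝ) / 2) * r ^ 2))) ^ ((1 : ℝ) / 2)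

/-- The two-thirds thresholding function `f_{2/3,λ}`. -/
noncomputable def f23 (lam r : ℝ) : ℝ :=
  (1 / 8) *
    (|phi23 lam r| +
      Real.sqrt (2 * |r| / |phi23 lam r| - (phi23 lam r) ^ 2)) ^ 3 * Real.sign r

/-- The threshold value `t_{2/3,λ} = (48^{1/4}/3)·λ^{3/4}`. -/
noncomputable def t23 (lam : ℝ) : ℝ :=
  (48 : ℝ) ^ ((1 : ℝ) / 4) / 3 * lam ^ ((3 : ℝ) / 4)

lemma cosh_arccosh_aux (x : ℝ) (hx : 1 ≤ x) : Real.cosh (arccosh x) = x := by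
  unfold arccosh
  have h1 : 0 ≤ x ^ 2 - 1 := by nlinarith
  have h2 := Real.sq_sqrt h1
  have h3 := Real.sqrt_nonneg (x ^ 2 - 1)
  set q := Real.sqrt (x ^ 2 - 1)
  have h4 : 0 < x + q := by linarith
  rw [Real.cosh_eq, Real.exp_neg, Real.exp_log h4]
  field_simp
  nlinarith

lemma t23_eq (a : ℝ) (ha : 0 < a) : t23 (3 * a ^ 4) = 2 * a ^ 3 := by
  unfold t23
  have e1 : ((48:ℝ) ^ ((1:ℝ)/4)) = 2 * 3 ^ ((1:ℝ)/4) := by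
    rw [show (48:ℝ) = 2 ^ 4 * 3 by norm_num, Real.mul_rpow (by norm_num) (by norm_num),
      ← Real.rpow_natCast 2 4, ← Real.rpow_mul (by norm_num)]
    norm_num
  have e2 : (a ^ 4) ^ ((3:ℝ)/4) = a ^ 3 := by
    rw [← Real.rpow_natCast a 4, ← Real.rpow_mul ha.le, ← Real.rpow_natCast a 3]
    norm_num
  have e3 : (3:ℝ) ^ ((1:ℝ)/4) * 3 ^ ((3:ℝ)/4) = 3 := by
    rw [← Real.rpow_add (by norm_num)]; norm_num
  rw [Real.mul_rpow (by norm_num) (by positivity), e1, e2]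
  linear_combination (2 / 3 * a ^ 3) * e3

lemma phi23_spec (L r : ℝ) (hL : 0 < L) (hr : r ≠ 0)
    (h : 1 ≤ (27 / 16) * L ^ (-(3 : ℝ) / 2) * r ^ 2) :
    0 < phi23 L r ∧ (phi23 L r) ^ 6 - 4 * L / 3 * (phi23 L r) ^ 2 - r ^ 2 = 0 := by
  have hc := cosh_arccosh_aux _ h
  unfold phi23
  set X := (27 / 16) * L ^ (-(3 : ℝ) / 2) * r ^ 2 with hX
  set θ := (1 / 3) * arccosh X with hθ
  have h3 : arccosh X = 3 * θ := by rw [hθ]; ring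
  rw [h3, Real.cosh_three_mul] at hc
  have hcp := Real.cosh_pos θ
  set c := Real.cosh θ
  have e1 : (c ^ ((1:ℝ)/2)) ^ 2 = c := by
    rw [← Real.rpow_natCast, ← Real.rpow_mul hcp.le]; norm_num
  have e2 : (L ^ ((1:ℝ)/4)) ^ 4 = L := by
    rw [← Real.rpow_natCast, ← Real.rpow_mul hL.le]; norm_num
  have e3 : L ^ (-(3 : ℝ) / 2) * (L ^ ((1:ℝ)/4)) ^ 6 = 1 := by
    rw [← Real.rpow_natCast, ← Real.rpow_mul hL.le, ← Real.rpow_add hL]; norm_num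
  have e4 : (2 / Real.sqrt 3) ^ 2 = 4 / 3 := by
    rw [div_pow, Real.sq_sqrt (by norm_num)]; norm_num
  refine ⟨by positivity, ?_⟩
  set l := L ^ ((1:ℝ)/4)
  have w : (2 / Real.sqrt 3 * l * c ^ ((1:ℝ)/2)) ^ 2 = 4 / 3 * l ^ 2 * c := by
    rw [mul_pow, mul_pow, e1, e4]
  rw [show (2 / Real.sqrt 3 * l * c ^ ((1:ℝ)/2)) ^ 6
    = ((2 / Real.sqrt 3 * l * c ^ ((1:ℝ)/2)) ^ 2) ^ 3 by ring, w]
  set M := L ^ (-(3 : ℝ) / 2)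
  rw [← e2]
  rw [hX] at hc
  linear_combination (16 / 27 * l ^ 6) * hc + r ^ 2 * e3

lemma one_dim (a r β : ℝ) (ha : 0 < a)
    (h : ∀ x : ℝ, (β - r) ^ 2 + 3 * a ^ 4 * |β| ^ ((2:ℝ)/3)
      ≤ (x - r) ^ 2 + 3 * a ^ 4 * |x| ^ ((2:ℝ)/3)) :
    (2 * a ^ 3 < |r| → β = f23 (3 * a ^ 4) r) ∧ (|r| < 2 * a ^ 3 → β = 0) := by
  have cube : ∀ u : ℝ, 0 ≤ u → (u ^ 3) ^ ((2:ℝ)/3) = u ^ 2 := by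
    intro u hu
    rw [← Real.rpow_natCast u 3, ← Real.rpow_mul hu, ← Real.rpow_natCast u 2]; norm_num
  obtain ⟨s, hs, hsβ⟩ : ∃ s : ℝ, 0 ≤ s ∧ |β| = s ^ 3 := by
    refine ⟨|β| ^ ((1:ℝ)/3), by positivity, ?_⟩
    rw [← Real.rpow_natCast, ← Real.rpow_mul (abs_nonneg _)]; norm_num
  have h1 : ∀ u : ℝ, 0 ≤ u → (β - r) ^ 2 + 3 * a ^ 4 * s ^ 2
      ≤ (u ^ 3 - |r|) ^ 2 + 3 * a ^ 4 * u ^ 2 := by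
    intro u hu
    have hu3 : 0 ≤ u ^ 3 := by positivity
    rcases le_total 0 r with hr | hr
    · have := h (u ^ 3)
      rw [hsβ, cube s hs, abs_of_nonneg hu3, cube u hu] at this
      rwa [abs_of_nonneg hr]
    · have := h (-u ^ 3)
      rw [hsβ, cube s hs, abs_neg, abs_of_nonneg hu3, cube u hu] at this
      rw [abs_of_nonpos hr]
      linarith
  have hb2 : β ^ 2 = (s ^ 3) ^ 2 := by rw [← hsβ, sq_abs]
  have hr2 := sq_abs r
  have hle : β * r ≤ s ^ 3 * |r| := by
    rw [← hsβ, ← abs_mul]; exact le_abs_self _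
  have hbr : β * r = s ^ 3 * |r| := by
    have := h1 s hs
    nlinarith
  have h2 : ∀ u : ℝ, 0 ≤ u → (s ^ 3 - |r|) ^ 2 + 3 * a ^ 4 * s ^ 2
      ≤ (u ^ 3 - |r|) ^ 2 + 3 * a ^ 4 * u ^ 2 := by
    intro u hu
    have := h1 u hu
    nlinarith
  have hR := abs_nonneg r
  have hpos : 0 < s → s ^ 4 - 2 * |r| * s + 3 * a ^ 4 ≤ 0 := by
    intro hs
    have := h2 0 le_rfl
    by_contra hc
    push Not at hc
    have := mul_pos (pow_pos hs 2) hc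
    nlinarith
  constructor
  · intro ht
    have hR0 : 0 < |r| := lt_trans (by positivity) ht
    have hr0 : r ≠ 0 := abs_pos.mp hR0
    have hs0 : 0 < s := by
      rcases hs.lt_or_eq with h0 | h0
      · exact h0
      · exfalso
        have h3 := h2 a ha.le
        rw [← h0] at h3
        have := mul_pos (pow_pos ha 3) (sub_pos.mpr ht)
        nlinarith
    have hcrit : s ^ 4 - |r| * s + a ^ 4 = 0 := by
      have hd : HasDerivAt (fun u : ℝ => (u ^ 3 - |r|) ^ 2 + 3 * a ^ 4 * u ^ 2)
          (2 * (s ^ 3 - |r|) * (3 * s ^ 2) + 3 * a ^ 4 * (2 * s)) s := by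
        have a1 := (((hasDerivAt_pow 3 s).sub_const |r|).pow 2).add
          ((hasDerivAt_pow 2 s).const_mul (3 * a ^ 4))
        refine HasDerivAt.congr_deriv a1 ?_
        norm_num
      have hm : IsLocalMin (fun u : ℝ => (u ^ 3 - |r|) ^ 2 + 3 * a ^ 4 * u ^ 2) s := by
        filter_upwards [lt_mem_nhds hs0] with u hu
        exact h2 u hu.le
      have h0 := hm.hasDerivAt_eq_zero hd
      have : 6 * s * (s ^ 4 - |r| * s + a ^ 4) = 0 := by linear_combination h0
      rcases mul_eq_zero.mp this with h | h
      · exact absurd h (by positivity)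
      · exact h
    have hp := hpos hs0
    have hs3 : |r| ≤ 2 * s ^ 3 := by
      have : s * (|r| - 2 * s ^ 3) ≤ 0 := by nlinarith
      nlinarith
    have hX : 1 ≤ (27 / 16) * (3 * a ^ 4) ^ (-(3 : ℝ) / 2) * r ^ 2 := by
      have e : ((3 * a ^ 4) ^ (-(3 : ℝ) / 2)) ^ 2 * (27 * a ^ 12) = 1 := by
        rw [show (27 * a ^ 12 : ℝ) = (3 * a ^ 4) ^ 3 by ring, ← Real.rpow_natCast,
          ← Real.rpow_natCast (3 * a ^ 4) 3, ← Real.rpow_mul (by positivity),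
          ← Real.rpow_add (by positivity)]
        norm_num
      have hM : 0 < (3 * a ^ 4) ^ (-(3 : ℝ) / 2) := by positivity
      set M := (3 * a ^ 4) ^ (-(3 : ℝ) / 2)
      have h4 : 4 * a ^ 6 ≤ r ^ 2 := by
        rw [← hr2]
        have := pow_le_pow_left₀ (by positivity) ht.le 2
        nlinarith
      have h5 : (27 / 16) * M * (4 * a ^ 6) ≤ (27 / 16) * M * r ^ 2 :=
        mul_le_mul_of_nonneg_left h4 (by positivity)
      refine le_trans ?_ h5
      by_contra hc
      push Not at hc
      have : ((27 / 16) * M * (4 * a ^ 6)) ^ 2 < 1 := by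
        apply pow_lt_one₀ (by positivity) hc (by norm_num)
      nlinarith
    obtain ⟨hφ, hφ6⟩ := phi23_spec (3 * a ^ 4) r (by positivity) hr0 hX
    unfold f23
    set φ := phi23 (3 * a ^ 4) r
    have hquad : s ^ 2 - φ * s + (φ ^ 2 - |r| / φ) / 2 = 0 := by
      have hf : (s ^ 2 - φ * s + (φ ^ 2 - |r| / φ) / 2) *
          (s ^ 2 + φ * s + (φ ^ 2 + |r| / φ) / 2) = 0 := by
        have hdd : φ * (|r| / φ) = |r| := by field_simp
        have hd2 : φ ^ 4 - 4 * a ^ 4 - (|r| / φ) ^ 2 = 0 := by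
          have : φ ^ 2 * (φ ^ 4 - 4 * a ^ 4 - (|r| / φ) ^ 2) = 0 := by
            linear_combination hφ6 - (φ * (|r| / φ) + |r|) * hdd - hr2
          rcases mul_eq_zero.mp this with h | h
          · exact absurd h (by positivity)
          · exact h
        linear_combination hcrit - s * hdd + hd2 / 4
      rcases mul_eq_zero.mp hf with h | h
      · exact h
      · exact absurd h (by positivity)
    have hge : φ ≤ 2 * s := by
      by_contra hc
      push Not at hc
      have hroot : (φ - s) ^ 4 - |r| * (φ - s) + a ^ 4 = 0 := by
        have hdd : φ * (|r| / φ) = |r| := by field_simp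
        have hd2 : φ ^ 4 - 4 * a ^ 4 - (|r| / φ) ^ 2 = 0 := by
          have : φ ^ 2 * (φ ^ 4 - 4 * a ^ 4 - (|r| / φ) ^ 2) = 0 := by
            linear_combination hφ6 - (φ * (|r| / φ) + |r|) * hdd - hr2
          rcases mul_eq_zero.mp this with h | h
          · exact absurd h (by positivity)
          · exact h
        linear_combination ((φ - s) ^ 2 + φ * (φ - s) + (φ ^ 2 + |r| / φ) / 2) * hquad
          + (φ - s) * hdd - hd2 / 4
      obtain ⟨d, hd⟩ : ∃ d, d = φ - 2 * s := ⟨_, rfl⟩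
      have hd0 : 0 < d := by linarith
      have e : φ - s = s + d := by linarith
      rw [e] at hroot
      have : d * (4 * s ^ 3 - |r| + 6 * s ^ 2 * d + 4 * s * d ^ 2 + d ^ 3) = 0 := by
        linear_combination hroot - hcrit
      have h7 : 0 < 4 * s ^ 3 - |r| + 6 * s ^ 2 * d + 4 * s * d ^ 2 + d ^ 3 := by
        have : 0 ≤ 4 * s ^ 3 - |r| := by nlinarith [pow_pos hs0 3]
        positivity
      exact absurd this (by positivity)
    have hD : 2 * |r| / φ - φ ^ 2 = (2 * s - φ) ^ 2 := by
      rw [mul_div_assoc]; linear_combination (-4) * hquad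
    rw [abs_of_pos hφ, hD, Real.sqrt_sq (by linarith)]
    have hfin : r * (β - s ^ 3 * Real.sign r) = 0 := by
      have h8 : r * Real.sign r = |r| := by
        rcases lt_or_gt_of_ne hr0 with h | h
        · rw [Real.sign_of_neg h, abs_of_neg h]; ring
        · rw [Real.sign_of_pos h, abs_of_pos h]; ring
      linear_combination hbr - s ^ 3 * h8
    rcases mul_eq_zero.mp hfin with h | h
    · exact absurd h hr0
    · linear_combination h
  · intro ht
    rcases hs.lt_or_eq with h0 | h0
    · exfalso
      have h3 := hpos h0
      have h4 : 0 ≤ (s - a) ^ 2 * (s ^ 2 + 2 * a * s + 3 * a ^ 2) := by positivity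
      have h5 := mul_pos h0 (sub_pos.mpr ht)
      nlinarith
    · rw [← h0] at hsβ
      simpa using hsβ

lemma Csur_sep {m n : ℕ} (A : Matrix (Fin m) (Fin n) ℝ) (b : Fin m → ℝ)
    (lam μ p : ℝ) (ε : Fin n → ℝ) (z y : Fin n → ℝ) :
    Csur A b lam μ p ((2 : ℝ) / 3) ε z y =
      (μ * ∑ j, ((b j) ^ 2 - (A.mulVec y j) ^ 2) + ∑ i, ((y i) ^ 2 - (Bmu A b μ y i) ^ 2)) +
      ∑ i, ((z i - Bmu A b μ y i) ^ 2 +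
        lam * μ / (|y i| + ε i) ^ ((2 : ℝ) / 3 - p) * |z i| ^ ((2 : ℝ) / 3)) := by
  have key : ∑ j, A.mulVec z j * (b j - A.mulVec y j) =
      ∑ i, z i * (A.transpose.mulVec (b - A.mulVec y)) i := by
    have := Matrix.dotProduct_mulVec (b - A.mulVec y) A z
    rw [← Matrix.mulVec_transpose] at this
    simp only [dotProduct, Pi.sub_apply] at this
    calc _ = _ := Finset.sum_congr rfl fun j _ => mul_comm _ _
      _ = _ := this
      _ = _ := Finset.sum_congr rfl fun j _ => mul_comm _ _
  have e1 : ∑ j, ((A.mulVec z - b) j) ^ 2 = ∑ j, ((A.mulVec z - A.mulVec y) j) ^ 2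
      + ∑ j, ((b j) ^ 2 - (A.mulVec y j) ^ 2)
      - 2 * ∑ j, A.mulVec z j * (b j - A.mulVec y j) := by
    rw [Finset.mul_sum, ← Finset.sum_add_distrib, ← Finset.sum_sub_distrib]
    refine Finset.sum_congr rfl fun j _ => ?_
    simp only [Pi.sub_apply]; ring
  have e2 : ∑ i, (z i - y i) ^ 2 =
      ∑ i, ((y i) ^ 2 - (Bmu A b μ y i) ^ 2) + ∑ i, (z i - Bmu A b μ y i) ^ 2
      + 2 * μ * ∑ i, z i * (A.transpose.mulVec (b - A.mulVec y)) i := by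
    rw [Finset.mul_sum, ← Finset.sum_add_distrib, ← Finset.sum_add_distrib]
    refine Finset.sum_congr rfl fun j _ => ?_
    simp only [Bmu, Pi.add_apply, Pi.smul_apply, smul_eq_mul]; ring
  have e3 : lam * μ * ∑ i, |z i| ^ ((2 : ℝ) / 3) / (|y i| + ε i) ^ ((2 : ℝ) / 3 - p) =
      ∑ i, lam * μ / (|y i| + ε i) ^ ((2 : ℝ) / 3 - p) * |z i| ^ ((2 : ℝ) / 3) := by
    rw [Finset.mul_sum]
    refine Finset.sum_congr rfl fun j _ => ?_
    ring
  unfold Csur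
  rw [e1, e2, e3, Finset.sum_add_distrib, key]
  ring

theorem stmt_16 {m n : ℕ} (A : Matrix (Fin m) (Fin n) ℝ) (b : Fin m → ℝ)
    (lam μ p : ℝ) (ε : Fin n → ℝ)
    (hlam : 0 < lam) (hμ : 0 < μ) (hp : p ∈ Set.Ioo (0 : ℝ) 1)
    (hε : ∀ i, 0 < ε i) (y : Fin n → ℝ) (ztilde : Fin n → ℝ)
    (hmin : ∀ z : Fin n → ℝ,
      Csur A b lam μ p ((2 : ℝ) / 3) ε ztilde y ≤ Csur A b lam μ p ((2 : ℝ) / 3) ε z y) :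
    ∀ i : Fin n,
      (t23 (lam * μ / (|y i| + ε i) ^ ((2 : ℝ) / 3 - p)) < |Bmu A b μ y i| →
        ztilde i = f23 (lam * μ / (|y i| + ε i) ^ ((2 : ℝ) / 3 - p)) (Bmu A b μ y i)) ∧
      (|Bmu A b μ y i| < t23 (lam * μ / (|y i| + ε i) ^ ((2 : ℝ) / 3 - p)) →
        ztilde i = 0) := by
  intro i
  have hw : 0 < |y i| + ε i := add_pos_of_nonneg_of_pos (abs_nonneg _) (hε i)
  have hL : 0 < lam * μ / (|y i| + ε i) ^ ((2 : ℝ) / 3 - p) := by positivity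
  have h1 : ∀ x : ℝ, (ztilde i - Bmu A b μ y i) ^ 2 +
        lam * μ / (|y i| + ε i) ^ ((2 : ℝ) / 3 - p) * |ztilde i| ^ ((2 : ℝ) / 3) ≤
      (x - Bmu A b μ y i) ^ 2 +
        lam * μ / (|y i| + ε i) ^ ((2 : ℝ) / 3 - p) * |x| ^ ((2 : ℝ) / 3) := by
    intro x
    have h := hmin (Function.update ztilde i x)
    rw [Csur_sep, Csur_sep] at h
    have h := le_of_add_le_add_left h
    rw [← Finset.add_sum_erase _ _ (Finset.mem_univ i),
      ← Finset.add_sum_erase _ _ (Finset.mem_univ i)] at h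
    rw [Finset.sum_congr rfl (s₁ := Finset.univ.erase i) (g := fun k =>
      (ztilde k - Bmu A b μ y k) ^ 2 +
        lam * μ / (|y k| + ε k) ^ ((2 : ℝ) / 3 - p) * |ztilde k| ^ ((2 : ℝ) / 3))
      (f := fun k => (Function.update ztilde i x k - Bmu A b μ y k) ^ 2 +
        lam * μ / (|y k| + ε k) ^ ((2 : ℝ) / 3 - p) *
          |Function.update ztilde i x k| ^ ((2 : ℝ) / 3))
      (fun k hk => by rw [Function.update_of_ne (Finset.ne_of_mem_erase hk)])] at h
    have h := le_of_add_le_add_right h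
    simpa using h
  set L := lam * μ / (|y i| + ε i) ^ ((2 : ℝ) / 3 - p)
  obtain ⟨a, ha, hLa⟩ : ∃ a : ℝ, 0 < a ∧ L = 3 * a ^ 4 := by
    refine ⟨(L / 3) ^ ((1:ℝ)/4), by positivity, ?_⟩
    rw [← Real.rpow_natCast, ← Real.rpow_mul (by positivity)]
    norm_num
    ring
  rw [hLa] at h1 ⊢
  rw [t23_eq a ha]
  exact one_dim a _ _ ha h1
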